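/- Let g ∈ G and X' ⊆ X. Assume that {(∂°g)⁻¹(y)}_{y∈ldom(B°g)} is a covering of X' ∩ udom g, and let Z_a (resp. Z_t) be the set of algebraically (resp. topologically) essential elements of ldom(B°g) with respect to this covering. Assume: (a) either Y is discrete, or b is continuous in the second variable and B°g(y) > −∞ for all y ∈ Y; and (b) either B°g ∈ F_c, or b is coercive and X' ⊆ idom g ∪ g⁻¹(−∞). Then Problem (P') has a solution, and every solution f of (P') satisfies f ≥ B°g and f(y) = B°g(y) for all y ∈ Z_a. If, in addition, B°g is quasi-continuous on its domain, then every solution f of (P') satisfies f(y) = B°g(y) for all y in the interior of Z_t relative to ldom(B°g). -/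

import Mathlib

noncomputable def Bop {X Y : Type*} (b : X → Y → EReal → EReal) (f : Y → EReal) : X → EReal :=
  fun x => ⨆ y, b x y (f y)

noncomputable def Bgal {X Y : Type*} (bo : Y → X → EReal → EReal) (g : X → EReal) : Y → EReal :=
  fun y => ⨆ x, bo y x (g x)

/-- Subdifferential of `f` at `y` with respect to the kernel `b`. -/
def subdiff {X Y : Type*} (b : X → Y → EReal → EReal) (S : Set (X × Y))
    (f : Y → EReal) (y : Y) : Set X :=
  {x | (x, y) ∈ S ∧ Bop b f x = b x y (f y)}

/-- Subdifferential of `g` at `x` with respect to the kernel `b°`. -/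
def subdiffo {X Y : Type*} (bo : Y → X → EReal → EReal) (S : Set (X × Y))
    (g : X → EReal) (x : X) : Set Y :=
  {y | (x, y) ∈ S ∧ Bgal bo g y = bo y x (g x)}

/-- `(∂°g)⁻¹(y)`. -/
def subdiffoInv {X Y : Type*} (bo : Y → X → EReal → EReal) (S : Set (X × Y))
    (g : X → EReal) (y : Y) : Set X :=
  {x | y ∈ subdiffo bo S g x}

def ldom {Z : Type*} (h : Z → EReal) : Set Z := {z | h z < ⊤}
def udom {Z : Type*} (h : Z → EReal) : Set Z := {z | ⊥ < h z}
def edom {Z : Type*} (h : Z → EReal) : Set Z := ldom h ∩ udom h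
def idom {Z : Type*} [TopologicalSpace Z] (h : Z → EReal) : Set Z :=
  {z | z ∈ edom h ∧ Filter.limsup h (nhds z) < ⊤}

/-- `b` is continuous in the second variable. -/
def Cont2 {X Y : Type*} [TopologicalSpace Y] (b : X → Y → EReal → EReal) : Prop :=
  ∀ (x : X) (α : ℝ), Continuous fun y => b x y (α : EReal)

/-- `b` is coercive. -/
def Coercive {X Y : Type*} [TopologicalSpace X] [TopologicalSpace Y]
    (b : X → Y → EReal → EReal) (bo : Y → X → EReal → EReal) : Prop :=
  ∀ x : X, ∀ V ∈ nhds x, ∀ (α β : ℝ),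
    IsCompact (closure {y : Y | (⨆ z ∈ V, b z y (bo y x (α : EReal))) ≤ (β : EReal)})

/-- `f ∈ F_c`: relatively compact finite superlevel sets. -/
def MemFc {X Y : Type*} [TopologicalSpace Y] (b : X → Y → EReal → EReal)
    (f : Y → EReal) : Prop :=
  ∀ (x : X) (β : ℝ), IsCompact (closure {y : Y | (β : EReal) ≤ b x y (f y)})

/-- `f` solves Problem (P') for the data `g`, `X'`. -/
def IsSolution {X Y : Type*} [TopologicalSpace Y] (b : X → Y → EReal → EReal)
    (g : X → EReal) (X' : Set X) (f : Y → EReal) : Prop :=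
  LowerSemicontinuous f ∧ (∀ x, Bop b f x ≤ g x) ∧ ∀ x ∈ X', Bop b f x = g x

def SemiOpen {Z : Type*} [TopologicalSpace Z] (s : Set Z) : Prop :=
  s ⊆ closure (interior s)

def QuasiContinuous {Z W : Type*} [TopologicalSpace Z] [TopologicalSpace W]
    (h : Z → W) : Prop :=
  ∀ G : Set W, IsOpen G → SemiOpen (h ⁻¹' G)

/-- `h` is quasi-continuous on its domain. -/
def QuasiContinuousOnDom {Z : Type*} [TopologicalSpace Z] (h : Z → EReal) : Prop :=
  QuasiContinuous fun z : edom h => h z.1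

/-- `y` is algebraically essential with respect to the covering of `W'` by `{Fm z}_{z ∈ Z'}`. -/
def AlgEssential {Z W : Type*} (Fm : Z → Set W) (Z' : Set Z) (W' : Set W) (y : Z) : Prop :=
  y ∈ Z' ∧ ∃ w ∈ W', ∀ z ∈ Z' \ {y}, w ∉ Fm z

/-- `y` is topologically essential with respect to the covering of `W'` by `{Fm z}_{z ∈ Z'}`. -/
def TopEssential {Z W : Type*} [TopologicalSpace Z] (Fm : Z → Set W) (Z' : Set Z)
    (W' : Set W) (y : Z) : Prop :=
  y ∈ Z' ∧ ∀ U : Set Z, IsOpen U → y ∈ U → ∃ w ∈ W', ∀ z ∈ Z' \ U, w ∉ Fm z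

section KernelLemmas

open Set Filter Topology

/-- An upper semicontinuous function with relatively compact finite superlevel sets attains its
supremum as soon as the latter is not `⊥`. -/
lemma UpperSemicontinuous.exists_eq_iSup_of_isCompact_closure {Y : Type*} [TopologicalSpace Y]
    {h : Y → EReal} (hh : UpperSemicontinuous h)
    (hc : ∀ β : ℝ, IsCompact (closure {y | (β : EReal) ≤ h y})) (hbot : ⊥ < ⨆ y, h y) :
    ∃ z, h z = ⨆ y, h y := by
  obtain ⟨β, -, hβ⟩ := EReal.lt_iff_exists_real_btwn.1 hbot
  obtain ⟨y₀, hy₀⟩ := lt_iSup_iff.1 hβ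
  have hK : IsCompact {y | (β : EReal) ≤ h y} :=
    (hc β).of_isClosed_subset (hh.isClosed_preimage β) subset_closure
  obtain ⟨z, hz, hmax⟩ := (hh.upperSemicontinuousOn _).exists_isMaxOn ⟨y₀, hy₀.le⟩ hK
  refine ⟨z, le_antisymm (le_iSup h z) (iSup_le fun y => ?_)⟩
  rcases le_total (β : EReal) (h y) with hy | hy
  · exact hmax hy
  · exact hy.trans hz

section Galois

variable {X Y : Type*} {b : X → Y → EReal → EReal} {bo : Y → X → EReal → EReal}

lemma antitone_of_kernel_galois (hgal : ∀ x y α β, b x y α ≤ β ↔ bo y x β ≤ α) (x : X) (y : Y) :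
    Antitone (b x y) := fun _ _ h =>
  (hgal ..).2 (((hgal ..).1 le_rfl).trans h)

lemma Bop_le_iff_Bgal_le (hgal : ∀ x y α β, b x y α ≤ β ↔ bo y x β ≤ α)
    {f : Y → EReal} {g : X → EReal} :
    (∀ x, Bop b f x ≤ g x) ↔ ∀ y, Bgal bo g y ≤ f y := by
  simp only [Bop, Bgal, iSup_le_iff, hgal]
  exact forall_comm

lemma kernel_rightInverse (hgal : ∀ x y α β, b x y α ≤ β ↔ bo y x β ≤ α) {x : X} {y : Y}
    (hb : Function.Bijective (b x y)) (β : EReal) : b x y (bo y x β) = β := by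
  obtain ⟨α, rfl⟩ := hb.2 β
  exact le_antisymm ((hgal ..).2 le_rfl)
    (antitone_of_kernel_galois hgal x y ((hgal ..).1 le_rfl))

lemma kernel_leftInverse (hgal : ∀ x y α β, b x y α ≤ β ↔ bo y x β ≤ α) {x : X} {y : Y}
    (hb : Function.Bijective (b x y)) (α : EReal) : bo y x (b x y α) = α :=
  hb.1 (kernel_rightInverse hgal hb _)

lemma le_kernel_iff (hgal : ∀ x y α β, b x y α ≤ β ↔ bo y x β ≤ α) {x : X} {y : Y}
    (hb : Function.Bijective (b x y)) {α β : EReal} : β ≤ b x y α ↔ α ≤ bo y x β := by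
  constructor <;> intro h
  · have := (hgal x y (bo y x β) (b x y α)).1 (by rwa [kernel_rightInverse hgal hb])
    rwa [kernel_leftInverse hgal hb] at this
  · have := antitone_of_kernel_galois hgal x y h
    rwa [kernel_rightInverse hgal hb] at this

lemma Bgal_lt_top_of_mem_subdiffoInv {S : Set (X × Y)}
    (hgal : ∀ x y α β, b x y α ≤ β ↔ bo y x β ≤ α)
    (hS : ∀ x y, (x, y) ∈ S → Function.Bijective (b x y)) {g : X → EReal} {x : X} {y : Y}
    (hxy : x ∈ subdiffoInv bo S g y) (hx : ⊥ < g x) : y ∈ ldom (Bgal bo g) := by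
  obtain ⟨hmem, heq⟩ := hxy
  change Bgal bo g y < ⊤
  refine lt_top_iff_ne_top.2 fun htop => hx.ne' (le_bot_iff.1 ?_)
  have hle := (le_kernel_iff hgal (hS x y hmem) (α := ⊤) (β := g x)).2 (by rw [← heq, htop])
  exact hle.trans ((hgal ..).2 le_top)

variable [TopologicalSpace Y]

lemma lowerSemicontinuous_Bgal (hbo : ∀ x α, LowerSemicontinuous fun y => bo y x α)
    (g : X → EReal) : LowerSemicontinuous (Bgal bo g) :=
  lowerSemicontinuous_iSup fun x => hbo x (g x)

lemma upperSemicontinuous_kernel_comp {S : Set (X × Y)}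
    (hgal : ∀ x y α β, b x y α ≤ β ↔ bo y x β ≤ α)
    (hS : ∀ x y, (x, y) ∈ S → Function.Bijective (b x y))
    (hS' : ∀ x y, (x, y) ∉ S → ∀ α, b x y α = ⊥) (hcont : Cont2 b)
    {f : Y → EReal} (hf : LowerSemicontinuous f) (hbot : ∀ y, ⊥ < f y) (x : X) :
    UpperSemicontinuous fun y => b x y (f y) := by
  intro y₀ β hβ
  obtain ⟨α, hαf, hαβ⟩ : ∃ α : ℝ, (α : EReal) < f y₀ ∧ b x y₀ α < β := by
    by_cases hy : (x, y₀) ∈ S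
    · obtain ⟨α, hα, hαf⟩ := EReal.lt_iff_exists_real_btwn.1
        (not_le.1 (mt (le_kernel_iff hgal (hS x y₀ hy)).2 (not_le.2 hβ)))
      exact ⟨α, hαf, not_le.1 (mt (le_kernel_iff hgal (hS x y₀ hy)).1 (not_le.2 hα))⟩
    · obtain ⟨α, -, hα⟩ := EReal.lt_iff_exists_real_btwn.1 (hbot y₀)
      refine ⟨α, hα, ?_⟩
      rw [hS' x y₀ hy]
      exact bot_le.trans_lt hβ
  filter_upwards [hf y₀ α hαf, (hcont x α).continuousAt.eventually_lt_const hαβ] with y h₁ h₂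
  exact (antitone_of_kernel_galois hgal x y h₁.le).trans_lt h₂

lemma isCompact_closure_superlevel_of_coercive [TopologicalSpace X] {S : Set (X × Y)}
    (hgal : ∀ x y α β, b x y α ≤ β ↔ bo y x β ≤ α)
    (hS : ∀ x y, (x, y) ∈ S → Function.Bijective (b x y))
    (hS' : ∀ x y, (x, y) ∉ S → ∀ α, b x y α = ⊥) (hcoer : Coercive b bo)
    {f : Y → EReal} {g : X → EReal} (hfg : ∀ x, Bop b f x ≤ g x) {x : X} (hx : x ∈ idom g)
    (β : ℝ) : IsCompact (closure {y | (β : EReal) ≤ b x y (f y)}) := by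
  obtain ⟨α, hα, -⟩ := EReal.lt_iff_exists_real_btwn.1 hx.2
  have hV : {z | g z < α} ∈ 𝓝 x := eventually_lt_of_limsup_lt hα
  refine (hcoer x _ hV β α).of_isClosed_subset isClosed_closure (closure_mono fun y hy => ?_)
  have hxy : (x, y) ∈ S := by
    by_contra hn
    rw [mem_ofPred_eq, hS' x y hn] at hy
    exact EReal.coe_ne_bot β (le_bot_iff.1 hy)
  change ⨆ z ∈ {z | g z < α}, b z y (bo y x β) ≤ α
  refine iSup₂_le fun z hz => ?_
  exact (antitone_of_kernel_galois hgal z y ((le_kernel_iff hgal (hS x y hxy)).1 hy)).trans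
    (((le_iSup (fun y => b z y (f y)) y).trans (hfg z)).trans (le_of_lt hz))

/-- Every solution coincides with `B°g` at some point of the subdifferential of `g` at each
`x ∈ X' ∩ udom g`. -/
lemma IsSolution.exists_mem_subdiffo_eq [TopologicalSpace X] {S : Set (X × Y)}
    (hgal : ∀ x y α β, b x y α ≤ β ↔ bo y x β ≤ α)
    (hS : ∀ x y, (x, y) ∈ S → Function.Bijective (b x y))
    (hS' : ∀ x y, (x, y) ∉ S → ∀ α, b x y α = ⊥) {g : X → EReal} {X' : Set X}
    (ha : DiscreteTopology Y ∨ (Cont2 b ∧ ∀ y, Bgal bo g y ≠ ⊥))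
    (hb : MemFc b (Bgal bo g) ∨ (Coercive b bo ∧ X' ⊆ idom g ∪ {x | g x = ⊥}))
    {f : Y → EReal} (hf : IsSolution b g X' f) {x : X} (hx : x ∈ X' ∩ udom g) :
    ∃ z ∈ ldom (Bgal bo g), x ∈ subdiffoInv bo S g z ∧ f z = Bgal bo g z := by
  obtain ⟨hlsc, hle, heq⟩ := hf
  have hge := (Bop_le_iff_Bgal_le hgal).1 hle
  have husc : UpperSemicontinuous fun y => b x y (f y) := by
    rcases ha with hd | ⟨hcont, hbot⟩
    · exact continuous_of_discreteTopology.upperSemicontinuous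
    · exact upperSemicontinuous_kernel_comp hgal hS hS' hcont hlsc
        (fun y => (bot_lt_iff_ne_bot.2 (hbot y)).trans_le (hge y)) x
  have hcpt : ∀ β : ℝ, IsCompact (closure {y | (β : EReal) ≤ b x y (f y)}) := by
    intro β
    rcases hb with hc | ⟨hcoer, hsub⟩
    · exact (hc x β).of_isClosed_subset isClosed_closure (closure_mono fun y hy =>
        le_trans hy (antitone_of_kernel_galois hgal x y (hge y)))
    · exact isCompact_closure_superlevel_of_coercive hgal hS hS' hcoer hle
        ((hsub hx.1).resolve_right (ne_of_gt hx.2)) β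
  have hsup : ⨆ y, b x y (f y) = g x := heq x hx.1
  obtain ⟨z, hz⟩ := husc.exists_eq_iSup_of_isCompact_closure hcpt (hsup ▸ hx.2)
  rw [hsup] at hz
  have hxz : (x, z) ∈ S := by
    by_contra hn
    rw [hS' x z hn] at hz
    exact (ne_of_gt hx.2) hz.symm
  have hfz : f z = bo z x (g x) := by rw [← hz, kernel_leftInverse hgal (hS x z hxz)]
  have hfB : f z = Bgal bo g z :=
    le_antisymm (hfz.trans_le (le_iSup (fun x => bo z x (g x)) x)) (hge z)
  have hmem : x ∈ subdiffoInv bo S g z := ⟨hxz, hfB.symm.trans hfz⟩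
  exact ⟨z, Bgal_lt_top_of_mem_subdiffoInv hgal hS hmem hx.2, hmem, hfB⟩

lemma isSolution_Bgal {S : Set (X × Y)}
    (hgal : ∀ x y α β, b x y α ≤ β ↔ bo y x β ≤ α)
    (hbo : ∀ x α, LowerSemicontinuous fun y => bo y x α)
    (hS : ∀ x y, (x, y) ∈ S → Function.Bijective (b x y)) {g : X → EReal} {X' : Set X}
    (hcov : X' ∩ udom g ⊆ ⋃ y ∈ ldom (Bgal bo g), subdiffoInv bo S g y) :
    IsSolution b g X' (Bgal bo g) := by
  have hle := (Bop_le_iff_Bgal_le hgal).2 fun y => le_refl (Bgal bo g y)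
  refine ⟨lowerSemicontinuous_Bgal hbo g, hle, fun x hx => (hle x).antisymm ?_⟩
  rcases eq_bot_or_bot_lt (g x) with hbot | hbot
  · exact hbot ▸ bot_le
  · obtain ⟨y, -, hmem, heq⟩ := mem_iUnion₂.1 (hcov ⟨hx, hbot⟩)
    refine le_trans (le_of_eq ?_) (le_iSup (fun y => b x y (Bgal bo g y)) y)
    rw [heq, kernel_rightInverse hgal (hS x y hmem)]

end Galois

end KernelLemmas

/-- Structure of the solutions of Problem (P') in terms of essential elements of
the covering. -/
theorem stmt13
    {X Y : Type*} [TopologicalSpace X] [TopologicalSpace Y] [T2Space X] [T2Space Y]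
    (b : X → Y → EReal → EReal) (bo : Y → X → EReal → EReal) (S : Set (X × Y))
    (hgal : ∀ (x : X) (y : Y) (α β : EReal), b x y α ≤ β ↔ bo y x β ≤ α)
    (hbo_lsc : ∀ (x : X) (α : EReal), LowerSemicontinuous fun y => bo y x α)
    (hS1 : ∀ x : X, ∃ y : Y, (x, y) ∈ S)
    (hS2 : ∀ y : Y, ∃ x : X, (x, y) ∈ S)
    (hS3 : ∀ x y, (x, y) ∈ S → Function.Bijective (b x y))
    (hS4 : ∀ x y, (x, y) ∉ S → ∀ α : EReal, b x y α = ⊥)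
    (g : X → EReal) (X' : Set X)
    (hcov : X' ∩ udom g ⊆ ⋃ y ∈ ldom (Bgal bo g), subdiffoInv bo S g y)
    (ha : DiscreteTopology Y ∨ (Cont2 b ∧ ∀ y : Y, Bgal bo g y ≠ ⊥))
    (hb : MemFc b (Bgal bo g) ∨ (Coercive b bo ∧ X' ⊆ idom g ∪ {x | g x = ⊥})) :
    (∃ f : Y → EReal, IsSolution b g X' f) ∧
    (∀ f : Y → EReal, IsSolution b g X' f →
      (∀ y : Y, Bgal bo g y ≤ f y) ∧
      (∀ y : Y, AlgEssential (subdiffoInv bo S g) (ldom (Bgal bo g)) (X' ∩ udom g) y →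
        f y = Bgal bo g y)) ∧
    (QuasiContinuousOnDom (Bgal bo g) →
      ∀ f : Y → EReal, IsSolution b g X' f →
        ∀ y : Y,
          TopEssential (subdiffoInv bo S g) (ldom (Bgal bo g)) (X' ∩ udom g) y →
          (∃ U : Set Y, IsOpen U ∧ y ∈ U ∧ ∀ z ∈ U ∩ ldom (Bgal bo g),
            TopEssential (subdiffoInv bo S g) (ldom (Bgal bo g)) (X' ∩ udom g) z) →
          f y = Bgal bo g y) := by
  have key : ∀ f, IsSolution b g X' f → ∀ x ∈ X' ∩ udom g,
      ∃ z ∈ ldom (Bgal bo g), x ∈ subdiffoInv bo S g z ∧ f z = Bgal bo g z :=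
    fun f hf x hx => hf.exists_mem_subdiffo_eq hgal hS3 hS4 ha hb hx
  have dense : ∀ f, IsSolution b g X' f → ∀ y,
      TopEssential (subdiffoInv bo S g) (ldom (Bgal bo g)) (X' ∩ udom g) y →
      ∀ U, IsOpen U → y ∈ U → ∃ z ∈ U ∩ ldom (Bgal bo g), f z = Bgal bo g z := by
    intro f hf y hy U hU hyU
    obtain ⟨w, hw, hnot⟩ := hy.2 U hU hyU
    obtain ⟨z, hz, hwz, hfz⟩ := key f hf w hw
    exact ⟨z, ⟨by_contra fun hzU => hnot z ⟨hz, hzU⟩ hwz, hz⟩, hfz⟩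
  refine ⟨⟨_, isSolution_Bgal hgal hbo_lsc hS3 hcov⟩, fun f hf =>
    ⟨(Bop_le_iff_Bgal_le hgal).1 hf.2.1, ?_⟩, ?_⟩
  · rintro y ⟨-, w, hw, hnot⟩
    obtain ⟨z, hz, hwz, hfz⟩ := key f hf w hw
    obtain rfl : z = y := by_contra fun hne => hnot z ⟨hz, hne⟩ hwz
    exact hfz
  · rintro hqc f hf y hy ⟨U, hU, hyU, hUt⟩
    rcases ha with hd | ⟨-, hbot⟩
    · obtain ⟨z, ⟨rfl, -⟩, hz⟩ := dense f hf y hy {y} (isOpen_discrete _) rfl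
      exact hz
    refine le_antisymm (not_lt.1 fun hlt => ?_) ((Bop_le_iff_Bgal_le hgal).1 hf.2.1 y)
    obtain ⟨α, hyα, hαf⟩ := EReal.lt_iff_exists_real_btwn.1 hlt
    have hdom : ∀ z ∈ ldom (Bgal bo g), z ∈ edom (Bgal bo g) :=
      fun z hz => ⟨hz, bot_lt_iff_ne_bot.2 (hbot z)⟩
    have hU₁ : IsOpen {z | (α : EReal) < f z} := hf.1.isOpen_preimage α
    have hcl := hqc (Set.Iio (α : EReal)) isOpen_Iio
      (show (⟨y, hdom y hy.1⟩ : edom (Bgal bo g)) ∈ _ from hyα)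
    obtain ⟨y₁, ⟨hy₁U, hy₁f⟩, hy₁⟩ := mem_closure_iff.1 hcl _
      ((hU.inter hU₁).preimage continuous_subtype_val) ⟨hyU, hαf⟩
    obtain ⟨V, hV, hVeq⟩ := isOpen_induced_iff.1
      (isOpen_interior (s := (fun z : edom (Bgal bo g) => Bgal bo g z.1) ⁻¹' Set.Iio (α : EReal)))
    rw [← hVeq] at hy₁
    obtain ⟨z, ⟨⟨hzf, hzV⟩, hz⟩, hfz⟩ := dense f hf y₁ (hUt y₁ ⟨hy₁U, y₁.2.1⟩) _
      (hU₁.inter hV) ⟨hy₁f, hy₁⟩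
    have hzint : (⟨z, hdom z hz⟩ : edom (Bgal bo g)) ∈ interior
        ((fun z : edom (Bgal bo g) => Bgal bo g z.1) ⁻¹' Set.Iio (α : EReal)) := by
      rw [← hVeq]
      exact hzV
    have hzα := interior_subset hzint
    have hzα' : (α : EReal) < Bgal bo g z := hfz ▸ hzf
    exact lt_asymm hzα hzα'
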